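/- Let Ψ₁, Ψ₂ ∈ ℂ³ be the unit vectors parameterized by (θ₁, φ₁, α₁, β₁) and (θ₂, φ₂, α₂, β₂), with θ_i ∈ [0, π], φ_i ∈ [0, π]. With P⁺ = (1/2)(S₊ + T₊), N⁺ = (1/2)(S₊ − T₊), P = (P⁺)^†, N = (N⁺)^†, the mixed two-site transfer expectation satisfies ⟨Ψ₁ ⊗ Ψ₂, (P⁺ ⊗ N + N ⊗ P⁺ + N⁺ ⊗ P + P ⊗ N⁺)(Ψ₁ ⊗ Ψ₂)⟩ = sin θ₁ sin θ₂ [ sin((φ₁ + φ₂)/2) cos((α₁ − α₂)/2) cos((β₁ + β₂)/2) + sin((φ₁ − φ₂)/2) sin((α₁ − α₂)/2) sin((β₁ + β₂)/2) ] / 2. -/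

import Mathlib

open Matrix Kronecker

/-- The pseudospin matrix `S_z = diag(1,0,−1)`. -/
noncomputable def Sz : Matrix (Fin 3) (Fin 3) ℂ := !![1, 0, 0; 0, 0, 0; 0, 0, -1]

/-- The pseudospin raising matrix `S₊`. -/
noncomputable def Sp : Matrix (Fin 3) (Fin 3) ℂ := !![0, 1, 0; 0, 0, 1; 0, 0, 0]

/-- `T₊ = S_z S₊ + S₊ S_z`. -/
noncomputable def Tp : Matrix (Fin 3) (Fin 3) ℂ := Sz * Sp + Sp * Sz

/-- The quasi-classical on-site wave function of the charge triplet. -/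
noncomputable def Psi (θ φ α β : ℝ) : Fin 3 → ℂ :=
  ![Complex.exp (-Complex.I * α / 2) * Real.sin (θ / 2) * Real.cos (φ / 2),
    Complex.exp (Complex.I * β / 2) * Real.cos (θ / 2),
    Complex.exp (Complex.I * α / 2) * Real.sin (θ / 2) * Real.sin (φ / 2)]

/-- The Kronecker (tensor) product of two on-site state vectors. -/
noncomputable def tens {m n : Type*} (v : m → ℂ) (w : n → ℂ) : m × n → ℂ :=
  fun p => v p.1 * w p.2

/-- The quantum expectation value `⟨v, A v⟩`. -/
noncomputable def expVal {n : Type*} [Fintype n] (A : Matrix n n ℂ) (v : n → ℂ) : ℂ :=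
  star v ⬝ᵥ A.mulVec v

theorem expVal_add {n : Type*} [Fintype n] (A B : Matrix n n ℂ) (v : n → ℂ) :
    expVal (A + B) v = expVal A v + expVal B v := by
  simp only [expVal, add_mulVec, dotProduct_add]

theorem expVal_conjTranspose {n : Type*} [Fintype n] (A : Matrix n n ℂ) (v : n → ℂ) :
    expVal Aᴴ v = star (expVal A v) := by
  rw [expVal, expVal, star_dotProduct, star_mulVec, conjTranspose_conjTranspose,
    dotProduct_mulVec]

theorem expVal_kronecker_tens {m n : Type*} [Fintype m] [Fintype n]
    (A : Matrix m m ℂ) (B : Matrix n n ℂ) (v : m → ℂ) (w : n → ℂ) :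
    expVal (A ⊗ₖ B) (tens v w) = expVal A v * expVal B w := by
  have h : (A ⊗ₖ B).mulVec (tens v w) = tens (A.mulVec v) (B.mulVec w) := by
    ext ⟨i, j⟩
    simp only [mulVec, dotProduct, tens, kroneckerMap_apply, Fintype.sum_prod_type,
      Finset.sum_mul_sum]
    exact Finset.sum_congr rfl fun _ _ => Finset.sum_congr rfl fun _ _ => by ring
  rw [expVal, h]
  simp only [expVal, dotProduct, tens, Pi.star_apply, star_mul', Fintype.sum_prod_type,
    Finset.sum_mul_sum]
  exact Finset.sum_congr rfl fun _ _ => Finset.sum_congr rfl fun _ _ => by ring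

theorem half_smul_Sp_add_Tp :
    (1 / 2 : ℂ) • (Sp + Tp) = !![0, 1, 0; 0, 0, 0; 0, 0, 0] := by
  ext i j
  fin_cases i <;> fin_cases j <;>
    norm_num [Sp, Tp, Sz, Matrix.mul_apply, Fin.sum_univ_three]

theorem half_smul_Sp_sub_Tp :
    (1 / 2 : ℂ) • (Sp - Tp) = !![0, 0, 0; 0, 0, 1; 0, 0, 0] := by
  ext i j
  fin_cases i <;> fin_cases j <;>
    norm_num [Sp, Tp, Sz, Matrix.mul_apply, Fin.sum_univ_three]

theorem exp_I_mul_div_two (x : ℝ) :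
    Complex.exp (Complex.I * x / 2) = ⟨Real.cos (x / 2), Real.sin (x / 2)⟩ := by
  have h : Complex.I * x / 2 = ((x / 2 : ℝ) : ℂ) * Complex.I := by push_cast; ring
  rw [h, Complex.exp_mul_I, ← Complex.ofReal_cos, ← Complex.ofReal_sin]
  apply Complex.ext <;> simp only [Complex.add_re, Complex.add_im, Complex.mul_re,
    Complex.mul_im, Complex.ofReal_re, Complex.ofReal_im, Complex.I_re, Complex.I_im] <;> ring

theorem exp_neg_I_mul_div_two (x : ℝ) :
    Complex.exp (-Complex.I * x / 2) = ⟨Real.cos (x / 2), -Real.sin (x / 2)⟩ := by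
  have h := exp_I_mul_div_two (-x)
  rw [neg_div, Real.cos_neg, Real.sin_neg] at h
  rw [← h]
  congr 1
  push_cast
  ring

theorem expVal_Sp_add_Tp_Psi (θ φ α β : ℝ) :
    expVal ((1 / 2 : ℂ) • (Sp + Tp)) (Psi θ φ α β) =
      ⟨Real.sin (θ / 2) * Real.cos (θ / 2) * Real.cos (φ / 2) *
          (Real.cos (α / 2) * Real.cos (β / 2) - Real.sin (α / 2) * Real.sin (β / 2)),
        Real.sin (θ / 2) * Real.cos (θ / 2) * Real.cos (φ / 2) *
          (Real.sin (α / 2) * Real.cos (β / 2) + Real.cos (α / 2) * Real.sin (β / 2))⟩ := by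
  rw [half_smul_Sp_add_Tp, expVal, Psi, exp_I_mul_div_two, exp_I_mul_div_two,
    exp_neg_I_mul_div_two]
  apply Complex.ext <;>
    simp [mulVec, dotProduct, Fin.sum_univ_three, -Complex.ofReal_sin, -Complex.ofReal_cos] <;>
    ring

theorem expVal_Sp_sub_Tp_Psi (θ φ α β : ℝ) :
    expVal ((1 / 2 : ℂ) • (Sp - Tp)) (Psi θ φ α β) =
      ⟨Real.sin (θ / 2) * Real.cos (θ / 2) * Real.sin (φ / 2) *
          (Real.cos (α / 2) * Real.cos (β / 2) + Real.sin (α / 2) * Real.sin (β / 2)),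
        Real.sin (θ / 2) * Real.cos (θ / 2) * Real.sin (φ / 2) *
          (Real.sin (α / 2) * Real.cos (β / 2) - Real.cos (α / 2) * Real.sin (β / 2))⟩ := by
  rw [half_smul_Sp_sub_Tp, expVal, Psi, exp_I_mul_div_two, exp_I_mul_div_two,
    exp_neg_I_mul_div_two]
  apply Complex.ext <;>
    simp [mulVec, dotProduct, Fin.sum_univ_three, -Complex.ofReal_sin, -Complex.ofReal_cos] <;>
    ring

/-- The mixed `PN`-type one-particle transfer expectation, where `P⁺ = (1/2)(S₊ + T₊)`,
`N⁺ = (1/2)(S₊ − T₊)`, `P = (P⁺)ᴴ`, `N = (N⁺)ᴴ`: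
`⟨Ψ₁ ⊗ Ψ₂, (P⁺ ⊗ N + N ⊗ P⁺ + N⁺ ⊗ P + P ⊗ N⁺)(Ψ₁ ⊗ Ψ₂)⟩
  = sin θ₁ sin θ₂ [sin((φ₁+φ₂)/2) cos((α₁−α₂)/2) cos((β₁+β₂)/2)
      + sin((φ₁−φ₂)/2) sin((α₁−α₂)/2) sin((β₁+β₂)/2)] / 2`. -/
theorem expVal_PN_transfer (θ₁ φ₁ α₁ β₁ θ₂ φ₂ α₂ β₂ : ℝ)
    (hθ₁ : θ₁ ∈ Set.Icc 0 Real.pi) (hφ₁ : φ₁ ∈ Set.Icc 0 Real.pi)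
    (hθ₂ : θ₂ ∈ Set.Icc 0 Real.pi) (hφ₂ : φ₂ ∈ Set.Icc 0 Real.pi) :
    expVal (((1 / 2 : ℂ) • (Sp + Tp)) ⊗ₖ ((1 / 2 : ℂ) • (Sp - Tp))ᴴ +
        ((1 / 2 : ℂ) • (Sp - Tp))ᴴ ⊗ₖ ((1 / 2 : ℂ) • (Sp + Tp)) +
        ((1 / 2 : ℂ) • (Sp - Tp)) ⊗ₖ ((1 / 2 : ℂ) • (Sp + Tp))ᴴ +
        ((1 / 2 : ℂ) • (Sp + Tp))ᴴ ⊗ₖ ((1 / 2 : ℂ) • (Sp - Tp)))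
      (tens (Psi θ₁ φ₁ α₁ β₁) (Psi θ₂ φ₂ α₂ β₂)) =
      ((Real.sin θ₁ * Real.sin θ₂ *
        (Real.sin ((φ₁ + φ₂) / 2) * Real.cos ((α₁ - α₂) / 2) * Real.cos ((β₁ + β₂) / 2) +
         Real.sin ((φ₁ - φ₂) / 2) * Real.sin ((α₁ - α₂) / 2) * Real.sin ((β₁ + β₂) / 2)) /
          2 : ℝ) : ℂ) := by
  have sin_eq (x : ℝ) : Real.sin x = 2 * Real.sin (x / 2) * Real.cos (x / 2) := by
    rw [← Real.sin_two_mul, mul_div_cancel₀ x two_ne_zero]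
  rw [sin_eq θ₁, sin_eq θ₂]
  simp only [expVal_add, expVal_kronecker_tens, expVal_conjTranspose,
    expVal_Sp_add_Tp_Psi, expVal_Sp_sub_Tp_Psi, add_div, sub_div,
    Real.sin_add, Real.sin_sub, Real.cos_add, Real.cos_sub]
  apply Complex.ext <;>
    simp only [Complex.add_re, Complex.add_im, Complex.mul_re, Complex.mul_im,
      Complex.star_def, Complex.conj_re, Complex.conj_im, Complex.ofReal_re,
      Complex.ofReal_im] <;>
    ring
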